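/- Let n ≥ 1, let W be a real n×n matrix with γ := ‖I − W‖_∞ < 1, let b ∈ ℝⁿ with b_j ≥ 0 for all j, and let H_p be the partition matrix of a partition p of {1,…,n}. Then the matrix I − (I − W)·H_p is invertible, and the vector x* := (I − (I − W)H_p)⁻¹·b satisfies, for every i ∈ {1,…,n}, x*_i ≥ min_{j} b_j − (γ/(1 − γ))·max_{j} b_j. -/

import Mathlib

open Matrix Filter

/-- The size of the block of the partition (equivalence relation) `p` containing `i`. -/
noncomputable def blockSize {n : ℕ} (p : Setoid (Fin n)) (i : Fin n) : ℕ :=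
  Set.ncard {k | p.r i k}

open Classical in
/-- The partition matrix `H_p` of a partition `p` of `{1,…,n}`:
`(H_p)_{ij} = 1/l_i` if `i` and `j` lie in the same block of `p` (`l_i` the cardinality of
the block containing `i`), and `(H_p)_{ij} = 0` otherwise. -/
noncomputable def partitionMatrix {n : ℕ} (p : Setoid (Fin n)) : Matrix (Fin n) (Fin n) ℝ :=
  Matrix.of fun i j => if p.r i j then (1 : ℝ) / (blockSize p i : ℝ) else 0

/-- The operator norm on `n × n` real matrices induced by the supremum norm on `ℝⁿ`,
i.e. the maximum absolute row sum. -/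
noncomputable def rowSumNorm {n : ℕ} (A : Matrix (Fin n) (Fin n) ℝ) : ℝ :=
  ⨆ i, ∑ j, |A i j|

theorem norm_mulVec_le_rowSumNorm_mul {n : ℕ} (A : Matrix (Fin n) (Fin n) ℝ)
    (v : Fin n → ℝ) : ‖A *ᵥ v‖ ≤ rowSumNorm A * ‖v‖ := by
  have hA : 0 ≤ rowSumNorm A :=
    Real.iSup_nonneg fun i => Finset.sum_nonneg fun j _ => abs_nonneg _
  refine (pi_norm_le_iff_of_nonneg (by positivity)).2 fun i => ?_
  calc ‖(A *ᵥ v) i‖ ≤ ∑ j, ‖A i j * v j‖ :=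
        norm_sum_le Finset.univ fun j => A i j * v j
    _ ≤ ∑ j, |A i j| * ‖v‖ := by
        refine Finset.sum_le_sum fun j _ => ?_
        rw [norm_mul, Real.norm_eq_abs (A i j)]
        gcongr
        exact norm_le_pi_norm v j
    _ = (∑ j, |A i j|) * ‖v‖ := by rw [Finset.sum_mul]
    _ ≤ rowSumNorm A * ‖v‖ := by
        gcongr
        exact le_ciSup (f := fun i => ∑ j, |A i j|) (Set.finite_range _).bddAbove i

theorem rowSumNorm_partitionMatrix_le_one {n : ℕ} (p : Setoid (Fin n)) :
    rowSumNorm (partitionMatrix p) ≤ 1 := by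
  classical
  refine Real.iSup_le (fun i => ?_) zero_le_one
  have hcard : blockSize p i = (Finset.univ.filter fun k => p.r i k).card := by
    rw [blockSize, ← Set.ncard_coe_finset]
    simp
  have hsum : ∑ j, |partitionMatrix p i j| = (blockSize p i : ℝ) * (1 / (blockSize p i : ℝ)) := by
    have habs : ∀ j, |partitionMatrix p i j| =
        if p.r i j then (1 : ℝ) / (blockSize p i : ℝ) else 0 := by
      intro j
      simp only [partitionMatrix, Matrix.of_apply]
      split_ifs
      · exact abs_of_nonneg (by positivity)
      · exact abs_zero
    simp_rw [habs]
    rw [← Finset.sum_filter, Finset.sum_const, nsmul_eq_mul, ← hcard]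
  rw [hsum, mul_one_div]
  exact div_self_le_one _

theorem norm_mul_partitionMatrix_mulVec_le {n : ℕ} (A : Matrix (Fin n) (Fin n) ℝ)
    (p : Setoid (Fin n)) (v : Fin n → ℝ) :
    ‖(A * partitionMatrix p) *ᵥ v‖ ≤ rowSumNorm A * ‖v‖ := by
  have hA : 0 ≤ rowSumNorm A :=
    Real.iSup_nonneg fun i => Finset.sum_nonneg fun j _ => abs_nonneg _
  rw [← Matrix.mulVec_mulVec]
  refine (norm_mulVec_le_rowSumNorm_mul _ _).trans (mul_le_mul_of_nonneg_left ?_ hA)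
  refine (norm_mulVec_le_rowSumNorm_mul _ _).trans ?_
  exact mul_le_of_le_one_left (norm_nonneg v) (rowSumNorm_partitionMatrix_le_one p)

/-- With `γ = ‖I − W‖_∞ < 1` and `b ≥ 0`, the matrix `I − (I − W)H_p` is invertible and every
component of `x* = (I − (I − W)H_p)⁻¹ b` is at least `min_j b_j − (γ/(1−γ)) max_j b_j`. -/
theorem equilibrium_component_lower_bound {n : ℕ} (hn : 1 ≤ n)
    (W : Matrix (Fin n) (Fin n) ℝ) (hW : rowSumNorm (1 - W) < 1)
    (b : Fin n → ℝ) (hb : ∀ j, 0 ≤ b j) (p : Setoid (Fin n)) :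
    IsUnit (1 - (1 - W) * partitionMatrix p) ∧
    ∀ i, (⨅ j, b j) - (rowSumNorm (1 - W) / (1 - rowSumNorm (1 - W))) * (⨆ j, b j)
      ≤ (1 - (1 - W) * partitionMatrix p)⁻¹.mulVec b i := by
  have hγ : 0 ≤ rowSumNorm (1 - W) :=
    Real.iSup_nonneg fun i => Finset.sum_nonneg fun j _ => abs_nonneg _
  have hA := norm_mul_partitionMatrix_mulVec_le (1 - W) p
  set γ := rowSumNorm (1 - W)
  set A := (1 - W) * partitionMatrix p
  have hunit : IsUnit (1 - A) := by
    rw [← Matrix.mulVec_injective_iff_isUnit]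
    intro v w hvw
    have hfix : A *ᵥ (v - w) = v - w := by
      have h : (1 - A) *ᵥ (v - w) = 0 := by
        rw [Matrix.mulVec_sub]
        exact sub_eq_zero.2 hvw
      rw [Matrix.sub_mulVec, Matrix.one_mulVec] at h
      exact (sub_eq_zero.1 h).symm
    have hle := hA (v - w)
    rw [hfix] at hle
    have hzero : ‖v - w‖ = 0 := by nlinarith [norm_nonneg (v - w)]
    exact sub_eq_zero.1 (norm_eq_zero.1 hzero)
  refine ⟨hunit, fun i => ?_⟩
  set x := (1 - A)⁻¹ *ᵥ b
  have hx : x = b + A *ᵥ x := by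
    have h : (1 - A) *ᵥ x = b := by
      rw [Matrix.mulVec_mulVec,
        Matrix.mul_nonsing_inv _ ((Matrix.isUnit_iff_isUnit_det _).1 hunit), Matrix.one_mulVec]
    rw [Matrix.sub_mulVec, Matrix.one_mulVec] at h
    rw [← h, sub_add_cancel]
  have hbM : ‖b‖ ≤ ⨆ j, b j := by
    refine (pi_norm_le_iff_of_nonneg (Real.iSup_nonneg hb)).2 fun j => ?_
    rw [Real.norm_of_nonneg (hb j)]
    exact le_ciSup (Set.finite_range b).bddAbove j
  have hxb : ‖x‖ ≤ ‖b‖ + γ * ‖x‖ := by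
    calc ‖x‖ = ‖b + A *ᵥ x‖ := congrArg norm hx
      _ ≤ ‖b‖ + ‖A *ᵥ x‖ := norm_add_le _ _
      _ ≤ ‖b‖ + γ * ‖x‖ := by gcongr; exact hA x
  have hxM : ‖x‖ ≤ (⨆ j, b j) / (1 - γ) := by
    rw [le_div_iff₀ (sub_pos.2 hW)]
    linarith
  have hAx : |(A *ᵥ x) i| ≤ γ / (1 - γ) * ⨆ j, b j := by
    calc |(A *ᵥ x) i| ≤ ‖A *ᵥ x‖ := norm_le_pi_norm (A *ᵥ x) i
      _ ≤ γ * ‖x‖ := hA x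
      _ ≤ γ * ((⨆ j, b j) / (1 - γ)) := by gcongr
      _ = γ / (1 - γ) * ⨆ j, b j := by ring
  have hmin : ⨅ j, b j ≤ b i := ciInf_le (Set.finite_range b).bddBelow i
  have hxi : x i = b i + (A *ᵥ x) i := congrFun hx i
  change _ ≤ x i
  linarith [neg_abs_le ((A *ᵥ x) i)]
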